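/- Fix a positive integer m, a Dyck word w of length 2m, and k < 2m with w_{k+1} = 1. Let H' be a graph on [k] such that H' = H[k] for some matching H on [2m] with base w avoiding every element of 𝒞 = {C_p : p ≥ 3}. Then for every stub x of H' that is the maximum of its ≈-block, there exists a matching H₀ on [2m] with base w avoiding every element of 𝒞 such that H₀[k] = H' and {x, k+1} is an edge of H₀. Consequently, the number of distinct graphs of the form H[k+1], where H ranges over matchings on [2m] with base w avoiding every element of 𝒞 and satisfying H[k] = H', equals the number of ≈-blocks of H'. -/

import Mathlib

/-- `G` is a matching on the vertex set `[n] = {1,…,n}`: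
every edge has both endpoints in `[n]`, and every vertex of `[n]` has exactly one neighbour. -/
def IsMatchingOn (n : ℕ) (G : SimpleGraph ℕ) : Prop :=
  (∀ u v : ℕ, G.Adj u v → 1 ≤ u ∧ u ≤ n ∧ 1 ≤ v ∧ v ≤ n) ∧
  (∀ v : ℕ, 1 ≤ v → v ≤ n → ∃! u : ℕ, G.Adj v u)

/-- `G` contains `H`: there is a monotone edge-preserving injection from the
vertices of `H` to those of `G`. -/
def ContainsPat (G H : SimpleGraph ℕ) : Prop :=
  ∃ f : ℕ → ℕ, StrictMono f ∧ ∀ u v : ℕ, H.Adj u v → G.Adj (f u) (f v)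

/-- `w` (on positions `1,…,n`) is a Dyck word of length `n`: exactly half of its letters
are `1` (`true`), and every prefix has at most half of its letters equal to `1`. -/
def IsDyckWord (n : ℕ) (w : ℕ → Bool) : Prop :=
  2 * ((Finset.Icc 1 n).filter fun i => w i = true).card = n ∧
  ∀ k : ℕ, k ≤ n → 2 * ((Finset.Icc 1 k).filter fun i => w i = true).card ≤ k

/-- The matching `G` on `[n]` has base `w`: `w i = 1` iff `i` is an r-vertex. -/
def HasBase (n : ℕ) (G : SimpleGraph ℕ) (w : ℕ → Bool) : Prop :=
  ∀ i : ℕ, 1 ≤ i → i ≤ n → (w i = true ↔ ∃ j : ℕ, j < i ∧ G.Adj i j)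

/-- The matching `M_123` on `[6]`, with edges `{1,4},{2,5},{3,6}`. -/
def M123 : SimpleGraph ℕ := SimpleGraph.fromRel fun u v => (u, v) ∈ [(1,4),(2,5),(3,6)]
/-- The matching `M_132` on `[6]`, with edges `{1,4},{2,6},{3,5}`. -/
def M132 : SimpleGraph ℕ := SimpleGraph.fromRel fun u v => (u, v) ∈ [(1,4),(2,6),(3,5)]
/-- The matching `M_213` on `[6]`, with edges `{1,5},{2,4},{3,6}`. -/
def M213 : SimpleGraph ℕ := SimpleGraph.fromRel fun u v => (u, v) ∈ [(1,5),(2,4),(3,6)]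
/-- The matching `M_231` on `[6]`, with edges `{1,5},{2,6},{3,4}`. -/
def M231 : SimpleGraph ℕ := SimpleGraph.fromRel fun u v => (u, v) ∈ [(1,5),(2,6),(3,4)]
/-- The matching `M_321` on `[6]`, with edges `{1,6},{2,5},{3,4}`. -/
def M321 : SimpleGraph ℕ := SimpleGraph.fromRel fun u v => (u, v) ∈ [(1,6),(2,5),(3,4)]

/-- The matching `C_k` on `[2k]`, with edges `{2i-1, 2i+2}` for `1 ≤ i < k`
together with the edge `{2, 2k-1}`. -/
def Ck (k : ℕ) : SimpleGraph ℕ :=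
  SimpleGraph.fromRel fun u v =>
    (∃ i : ℕ, 1 ≤ i ∧ i < k ∧ u = 2*i - 1 ∧ v = 2*i + 2) ∨ (u = 2 ∧ v = 2*k - 1)

/-- `G[k]`: the subgraph of `G` induced by the vertex set `[k]`. -/
def restrictG (G : SimpleGraph ℕ) (k : ℕ) : SimpleGraph ℕ :=
  SimpleGraph.fromRel fun u v => G.Adj u v ∧ u ≤ k ∧ v ≤ k

/-- A stub of a graph on `[k]`: an isolated vertex. -/
def IsStubOn (k : ℕ) (G : SimpleGraph ℕ) (v : ℕ) : Prop :=
  1 ≤ v ∧ v ≤ k ∧ ∀ u : ℕ, ¬ G.Adj v u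

/-- The relation `∼`: `u ∼ v` iff `u = v` or some edge `{x,y}` satisfies
`x < u < y` and `x < v < y`. -/
def SimRel (G : SimpleGraph ℕ) (u v : ℕ) : Prop :=
  u = v ∨ ∃ x y : ℕ, G.Adj x y ∧ x < u ∧ u < y ∧ x < v ∧ v < y

/-- The edges `{a,b}` and `{c,d}` (with `a < b`, `c < d`) cross. -/
def EdgesCross (a b c d : ℕ) : Prop :=
  (a < c ∧ c < b ∧ b < d) ∨ (c < a ∧ a < d ∧ d < b)

/-- The relation `≈`: `u ≈ v` iff `u = v` or there is a sequence of edges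
`e_1,…,e_p` (`p ≥ 1`), consecutive ones crossing, with `e_1` spanning `u` and `e_p` spanning `v`. -/
def ApproxRel (G : SimpleGraph ℕ) (u v : ℕ) : Prop :=
  u = v ∨ ∃ p : ℕ, 1 ≤ p ∧ ∃ x y : ℕ → ℕ,
    (∀ i : ℕ, i < p → x i < y i ∧ G.Adj (x i) (y i)) ∧
    (∀ i : ℕ, i + 1 < p → EdgesCross (x i) (y i) (x (i+1)) (y (i+1))) ∧
    x 0 < u ∧ u < y 0 ∧ x (p-1) < v ∧ v < y (p-1)

/-- `Reach G b a y`: the right endpoint `y` is reached from `a` by a left-to-right chain of edges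
of `G`, all of them ending before `b`, the first of them spanning `a`. -/
inductive Reach (G : SimpleGraph ℕ) (b a : ℕ) : ℕ → Prop
  | base {x y : ℕ} : G.Adj x y → x < a → a < y → y < b → Reach G b a y
  | step {x y y₁ : ℕ} : Reach G b a y → G.Adj x y₁ → x < y → y < y₁ → y₁ < b → Reach G b a y₁

/-- A left-to-right chain of `q` edges of `G` from `a` to `z` in which only consecutive edges
cross, only the first edge spans `a`, and only the last edge spans `z`. -/
structure IsTightChain (G : SimpleGraph ℕ) (b a z q : ℕ) (x y : ℕ → ℕ) : Prop where
  pos : 1 ≤ q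
  adj : ∀ i < q, G.Adj (x i) (y i)
  lt_bound : ∀ i < q, y i < b
  left_lt : x 0 < a
  lt_right : a < y 0
  cross : ∀ i, i + 1 < q → x (i + 1) < y i
  right_lt : ∀ i, i + 1 < q → y i < y (i + 1)
  gap : ∀ i, i + 2 < q → y i < x (i + 2)
  second : 1 < q → a < x 1
  last_left : x (q - 1) < z
  last_right : z < y (q - 1)
  before : ∀ i, i + 1 < q → y i < z

/-- A partial matching on `[n]` with base `w` that can be completed without creating any `C_p`. -/
structure IsExtendable (w : ℕ → Bool) (n : ℕ) (G : SimpleGraph ℕ) : Prop where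
  range : ∀ u v, G.Adj u v → 1 ≤ u ∧ u ≤ n
  unique : ∀ u v v', G.Adj u v → G.Adj u v' → v = v'
  base : ∀ i, 1 ≤ i → i ≤ n → (w i = true ↔ ∃ j, j < i ∧ G.Adj i j)
  noReach : ∀ a b z y, G.Adj a b → a < z → z < b → (∀ t, G.Adj z t → b < t) →
    Reach G b a y → y ≤ z

/-- The graph `G` with the additional edge `{x, y}`. -/
def insertEdge (G : SimpleGraph ℕ) (x y : ℕ) : SimpleGraph ℕ :=
  SimpleGraph.fromRel fun u v => G.Adj u v ∨ (u = x ∧ v = y)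

theorem restrictG_adj {G : SimpleGraph ℕ} {k u v : ℕ} :
    (restrictG G k).Adj u v ↔ G.Adj u v ∧ u ≤ k ∧ v ≤ k := by
  simp only [restrictG, SimpleGraph.fromRel_adj]
  constructor
  · rintro ⟨-, h | h⟩
    · exact h
    · exact ⟨h.1.symm, h.2.2, h.2.1⟩
  · intro h
    exact ⟨h.1.ne, Or.inl h⟩

theorem insertEdge_adj {G : SimpleGraph ℕ} {x y u v : ℕ} (hxy : x ≠ y) :
    (insertEdge G x y).Adj u v ↔ G.Adj u v ∨ (u = x ∧ v = y) ∨ (u = y ∧ v = x) := by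
  simp only [insertEdge, SimpleGraph.fromRel_adj]
  constructor
  · rintro ⟨-, (h | h) | h | h⟩
    · exact Or.inl h
    · exact Or.inr (Or.inl h)
    · exact Or.inl h.symm
    · exact Or.inr (Or.inr ⟨h.2, h.1⟩)
  · rintro (h | ⟨rfl, rfl⟩ | ⟨rfl, rfl⟩)
    · exact ⟨h.ne, Or.inl (Or.inl h)⟩
    · exact ⟨hxy, Or.inl (Or.inr ⟨rfl, rfl⟩)⟩
    · exact ⟨hxy.symm, Or.inr (Or.inr ⟨rfl, rfl⟩)⟩

theorem Reach.mono {G G' : SimpleGraph ℕ} {b a y : ℕ}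
    (hG : ∀ u v, v < b → u < v → G.Adj u v → G'.Adj u v) (h : Reach G b a y) :
    Reach G' b a y := by
  induction h with
  | base h1 h2 h3 h4 => exact .base (hG _ _ h4 (by omega) h1) h2 h3 h4
  | step _ h1 h2 h3 h4 ih => exact .step ih (hG _ _ h4 (by omega) h1) h2 h3 h4

theorem Reach.exists_adj {G : SimpleGraph ℕ} {b a y : ℕ} (h : Reach G b a y) :
    ∃ x, x < y ∧ G.Adj x y := by
  cases h with
  | base h1 h2 h3 _ => exact ⟨_, by omega, h1⟩
  | step _ h1 h2 h3 _ => exact ⟨_, by omega, h1⟩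

theorem Reach.trans {G : SimpleGraph ℕ} {b u v y y' : ℕ} (h : Reach G b u y) (hv : v < y)
    (h' : Reach G b v y') : ∃ t, y' ≤ t ∧ Reach G b u t := by
  induction h' with
  | @base x₁ y₁ h1 h2 h3 h4 =>
    by_cases hy : y₁ ≤ y
    · exact ⟨y, hy, h⟩
    · exact ⟨y₁, le_rfl, .step h h1 (by omega) (by omega) h4⟩
  | @step x₁ y₀ y₁ _ h1 h2 h3 h4 ih =>
    obtain ⟨t, ht, hr⟩ := ih
    by_cases hy : y₁ ≤ t
    · exact ⟨t, hy, hr⟩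
    · exact ⟨y₁, le_rfl, .step hr h1 (by omega) (by omega) h4⟩

theorem Reach.shift {G : SimpleGraph ℕ} {b u v y : ℕ} (h : Reach G b u y) (huv : u < v) :
    y ≤ v ∨ ∃ t, y ≤ t ∧ Reach G b v t := by
  induction h with
  | @base x₁ y₁ h1 h2 h3 h4 =>
    by_cases hy : y₁ ≤ v
    · exact Or.inl hy
    · exact Or.inr ⟨y₁, le_rfl, .base h1 (by omega) (by omega) h4⟩
  | @step x₁ y₀ y₁ _ h1 h2 h3 h4 ih =>
    by_cases hy : y₁ ≤ v
    · exact Or.inl hy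
    right
    rcases ih with ih | ⟨t, ht, hr⟩
    · exact ⟨y₁, le_rfl, .base h1 (by omega) (by omega) h4⟩
    · by_cases hyt : y₁ ≤ t
      · exact ⟨t, hyt, hr⟩
      · exact ⟨y₁, le_rfl, .step hr h1 (by omega) (by omega) h4⟩

theorem Reach.exists_isTightChain {G : SimpleGraph ℕ} {b a y : ℕ}
    (hu : ∀ u v v', G.Adj u v → G.Adj u v' → v = v') (ha : ∀ t, G.Adj a t → b ≤ t)
    (h : Reach G b a y) :
    ∀ z, a < z → z < y → (∀ t, G.Adj z t → z < t) →
      ∃ q c d, IsTightChain G b a z q c d ∧ d (q - 1) ≤ y := by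
  have single : ∀ x y z, G.Adj x y → x < a → a < z → z < y → y < b →
      ∃ q c d, IsTightChain G b a z q c d ∧ d (q - 1) ≤ y := by
    intro x y z h1 h2 h3 h4 h5
    refine ⟨1, fun _ => x, fun _ => y, ?_, le_rfl⟩
    constructor <;> intros <;> first | assumption | omega
  induction h with
  | base h1 h2 h3 h4 =>
    intro z hz hzy _
    exact single _ _ z h1 h2 hz hzy h4
  | @step x₁ y₀ y₁ h0 h1 h2 h3 h4 ih =>
    intro z hz hzy hzr
    obtain ⟨s, hs, hsa⟩ := h0.exists_adj
    rcases lt_trichotomy z y₀ with hlt | heq | hgt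
    · obtain ⟨q, c, d, hc, hd⟩ := ih z hz hlt hzr
      exact ⟨q, c, d, hc, by omega⟩
    · subst heq
      have := hzr s hsa.symm
      omega
    · rcases lt_trichotomy x₁ a with hxa | hxa | hxa
      · exact single _ _ z h1 hxa hz hzy h4
      · subst hxa
        have := ha _ h1
        omega
      · obtain ⟨q, c, d, hc, hd⟩ := ih x₁ hxa h2 (by
          intro t ht
          have := hu _ _ _ ht h1
          omega)
        have hq := hc.pos
        refine ⟨q + 1, fun i => if i < q then c i else x₁, fun i => if i < q then d i else y₁,
          ?_, by simp⟩
        have hlast : ∀ i, i + 1 = q → d i ≤ y₀ ∧ x₁ < d i := by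
          intro i hi
          obtain rfl : i = q - 1 := by omega
          exact ⟨hd, hc.last_right⟩
        have h0q : 0 < q := hq
        constructor
        · omega
        · intro i hi
          by_cases hiq : i < q
          · simpa [hiq] using hc.adj i hiq
          · simpa [hiq] using h1
        · intro i hi
          by_cases hiq : i < q
          · simpa [hiq] using hc.lt_bound i hiq
          · simpa [hiq] using h4
        · simpa [h0q] using hc.left_lt
        · simpa [h0q] using hc.lt_right
        · intro i hi
          by_cases hiq : i + 1 < q
          · simpa [hiq, show i < q by omega] using hc.cross i hiq
          · simpa [hiq, show i < q by omega] using (hlast i (by omega)).2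
        · intro i hi
          by_cases hiq : i + 1 < q
          · simpa [hiq, show i < q by omega] using hc.right_lt i hiq
          · have := (hlast i (by omega)).1
            simp only [hiq, show i < q by omega, if_true, if_false]
            omega
        · intro i hi
          by_cases hiq : i + 2 < q
          · simpa [hiq, show i < q by omega] using hc.gap i hiq
          · simpa [hiq, show i < q by omega] using hc.before i (by omega)
        · intro _
          by_cases hiq : 1 < q
          · simpa [hiq] using hc.second hiq
          · simpa [hiq] using hxa
        · simp only [Nat.add_sub_cancel, lt_irrefl, if_false]
          omega
        · simpa using hzy
        · intro i hi
          simp only [show i < q by omega, if_true]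
          by_cases hiq : i + 1 < q
          · have := hc.before i hiq
            omega
          · have := (hlast i (by omega)).1
            omega

theorem IsTightChain.left_lt_left {G : SimpleGraph ℕ} {b a z q : ℕ} {x y : ℕ → ℕ}
    (h : IsTightChain G b a z q x y) (i : ℕ) (hi : i + 1 < q) : x i < x (i + 1) := by
  rcases i with _ | i
  · have := h.left_lt
    have := h.second hi
    simp only [zero_add]
    omega
  · have := h.cross i (by omega)
    have := h.gap i (by omega)
    simp only [add_assoc, Nat.reduceAdd] at *
    omega

theorem IsTightChain.left_lt_right {G : SimpleGraph ℕ} {b a z q : ℕ} {x y : ℕ → ℕ}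
    (h : IsTightChain G b a z q x y) (i : ℕ) (hi : i < q) : x i < y i := by
  rcases i with _ | i
  · have := h.left_lt
    have := h.lt_right
    omega
  · have := h.cross i hi
    have := h.right_lt i hi
    omega

theorem IsTightChain.approxRel {G : SimpleGraph ℕ} {b a z q : ℕ} {x y : ℕ → ℕ}
    (h : IsTightChain G b a z q x y) : ApproxRel G a z := by
  refine Or.inr ⟨q, h.pos, x, y, fun i hi => ⟨h.left_lt_right i hi, h.adj i hi⟩, ?_,
    h.left_lt, h.lt_right, h.last_left, h.last_right⟩
  intro i hi
  exact Or.inl ⟨h.left_lt_left i hi, h.cross i hi, h.right_lt i hi⟩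

theorem IsTightChain.containsPat {G : SimpleGraph ℕ} {b a z q t : ℕ} {x y : ℕ → ℕ}
    (h : IsTightChain G b a z q x y) (h0 : 0 < x 0) (hab : G.Adj a b) (hzt : G.Adj z t)
    (haz : a < z) (hbt : b < t) : ContainsPat G (Ck (q + 2)) := by
  have hq := h.pos
  let f : ℕ → ℕ := fun n =>
    if n = 0 then 0 else if n = 2 then a else if n = 2 * q + 1 then z
    else if n = 2 * q + 3 then b else if 2 * q + 4 ≤ n then t + (n - (2 * q + 4))
    else if n % 2 = 1 then x (n / 2) else y (n / 2 - 2)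
  have f0 : f 0 = 0 := by simp [f]
  have f2 : f 2 = a := by simp [f]
  have fz : f (2 * q + 1) = z := by
    simp only [f]
    rw [if_neg (by omega), if_neg (by omega), if_pos trivial]
  have fb : f (2 * q + 3) = b := by
    simp only [f]
    rw [if_neg (by omega), if_neg (by omega), if_neg (by omega), if_pos trivial]
  have ft : ∀ j, f (2 * q + 4 + j) = t + j := by
    intro j
    simp only [f]
    rw [if_neg (by omega), if_neg (by omega), if_neg (by omega), if_neg (by omega),
      if_pos (by omega)]
    omega
  have fx : ∀ i < q, f (2 * i + 1) = x i := by
    intro i hi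
    simp only [f]
    rw [if_neg (by omega), if_neg (by omega), if_neg (by omega), if_neg (by omega),
      if_neg (by omega), if_pos (by omega)]
    congr 1
    omega
  have fy : ∀ i < q, f (2 * i + 4) = y i := by
    intro i hi
    simp only [f]
    rw [if_neg (by omega), if_neg (by omega), if_neg (by omega), if_neg (by omega),
      if_neg (by omega), if_neg (by omega)]
    congr 1
    omega
  have hmono : StrictMono f := by
    refine strictMono_nat_of_lt_succ fun n => ?_
    rcases Nat.even_or_odd' n with ⟨i, rfl | rfl⟩
    · rcases i with _ | _ | i
      · have := fx 0 (by omega)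
        simp only [mul_zero, zero_add] at *
        omega
      · by_cases h1 : 1 < q
        · have := fx 1 h1
          have := h.second h1
          simp only [mul_one, zero_add, Nat.reduceAdd] at *
          omega
        · obtain rfl : q = 1 := by omega
          simp only [mul_one, zero_add, Nat.reduceAdd] at *
          omega
      · rw [show 2 * (i + 1 + 1) = 2 * i + 4 by ring]
        rcases lt_trichotomy (i + 2) q with hi | hi | hi
        · have e := fx (i + 2) hi
          rw [show 2 * (i + 2) + 1 = 2 * i + 4 + 1 by ring] at e
          rw [e, fy i (by omega)]
          exact h.gap i hi
        · rw [show 2 * i + 4 + 1 = 2 * q + 1 by omega, fz, fy i (by omega)]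
          exact h.before i (by omega)
        · by_cases hi' : i < q
          · obtain rfl : i = q - 1 := by omega
            rw [show 2 * (q - 1) + 4 + 1 = 2 * q + 3 by omega, fb, fy _ hi']
            exact h.lt_bound _ hi'
          · have e := ft (2 * (i - q))
            have e' := ft (2 * (i - q) + 1)
            rw [show 2 * q + 4 + 2 * (i - q) = 2 * i + 4 by omega] at e
            rw [show 2 * q + 4 + (2 * (i - q) + 1) = 2 * i + 4 + 1 by omega] at e'
            omega
    · rcases i with _ | i
      · have := fx 0 (by omega)
        have := h.left_lt
        simp only [mul_zero, zero_add, Nat.reduceAdd] at *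
        omega
      · rw [show 2 * (i + 1) + 1 + 1 = 2 * i + 4 by ring]
        rcases lt_trichotomy (i + 1) q with hi | hi | hi
        · rw [fx (i + 1) hi, fy i (by omega)]
          exact h.cross i hi
        · have := h.last_right
          rw [hi, fz, fy i (by omega)]
          rwa [show i = q - 1 by omega]
        · by_cases hi' : i = q
          · subst hi'
            have := ft 0
            rw [show 2 * (i + 1) + 1 = 2 * i + 3 by ring, fb]
            simp only [add_zero] at this
            omega
          · have e := ft (2 * (i - q - 1) + 1)
            have e' := ft (2 * (i - q - 1) + 2)
            rw [show 2 * q + 4 + (2 * (i - q - 1) + 1) = 2 * (i + 1) + 1 by omega] at e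
            rw [show 2 * q + 4 + (2 * (i - q - 1) + 2) = 2 * i + 4 by omega] at e'
            omega
  refine ⟨f, hmono, ?_⟩
  have key : ∀ u v : ℕ, ((∃ i : ℕ, 1 ≤ i ∧ i < q + 2 ∧ u = 2*i - 1 ∧ v = 2*i + 2) ∨
      (u = 2 ∧ v = 2*(q + 2) - 1)) → G.Adj (f u) (f v) := by
    rintro u v (⟨i, h1, h2, rfl, rfl⟩ | ⟨rfl, rfl⟩)
    · by_cases hi : i ≤ q
      · have e := fx (i - 1) (by omega)
        have e' := fy (i - 1) (by omega)
        rw [show 2 * (i - 1) + 1 = 2 * i - 1 by omega] at e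
        rw [show 2 * (i - 1) + 4 = 2 * i + 2 by omega] at e'
        rw [e, e']
        exact h.adj _ (by omega)
      · obtain rfl : i = q + 1 := by omega
        have e := ft 0
        rw [show 2 * (q + 1) - 1 = 2 * q + 1 by omega,
          show 2 * (q + 1) + 2 = 2 * q + 4 + 0 by ring, fz, e]
        exact hzt
    · rw [show 2 * (q + 2) - 1 = 2 * q + 3 by omega, f2, fb]
      exact hab
  intro u v huv
  simp only [Ck, SimpleGraph.fromRel_adj] at huv
  rcases huv.2 with hk | hk
  · exact key u v hk
  · exact (key v u hk).symm

/-- Every copy of some `C_p` gives rise to a chain forbidden by `IsExtendable.noReach`. -/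
theorem exists_reach_of_containsPat {G : SimpleGraph ℕ} {p : ℕ} (hp : 3 ≤ p)
    (h : ContainsPat G (Ck p)) :
    ∃ a b z t y, G.Adj a b ∧ a < z ∧ z < b ∧ G.Adj z t ∧ b < t ∧ Reach G b a y ∧ z < y := by
  obtain ⟨f, hf, hadj⟩ := h
  have edge : ∀ i, 1 ≤ i → i < p → G.Adj (f (2 * i - 1)) (f (2 * i + 2)) := by
    intro i h1 h2
    refine hadj _ _ ?_
    simp only [Ck, SimpleGraph.fromRel_adj]
    exact ⟨by omega, Or.inl (Or.inl ⟨i, h1, h2, rfl, rfl⟩)⟩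
  have reach : ∀ i, i + 3 ≤ p → Reach G (f (2 * p - 1)) (f 2) (f (2 * (i + 1) + 2)) := by
    intro i
    induction i with
    | zero =>
      intro hi
      exact .base (edge 1 (by omega) (by omega)) (hf (by omega)) (hf (by omega)) (hf (by omega))
    | succ i ih =>
      intro hi
      exact .step (ih (by omega)) (edge (i + 1 + 1) (by omega) (by omega)) (hf (by omega))
        (hf (by omega)) (hf (by omega))
  refine ⟨f 2, f (2 * p - 1), f (2 * (p - 1) - 1), f (2 * (p - 1) + 2), _, ?_, hf (by omega),
    hf (by omega), edge (p - 1) (by omega) (by omega), hf (by omega),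
    reach (p - 3) (by omega), hf (by omega)⟩
  refine hadj _ _ ?_
  simp only [Ck, SimpleGraph.fromRel_adj]
  exact ⟨by omega, Or.inl (Or.inr ⟨trivial, trivial⟩)⟩

theorem IsMatchingOn.isExtendable {n : ℕ} {H : SimpleGraph ℕ} {w : ℕ → Bool}
    (hM : IsMatchingOn n H) (hB : HasBase n H w)
    (hC : ∀ p : ℕ, 3 ≤ p → ¬ ContainsPat H (Ck p)) : IsExtendable w n H := by
  have hu : ∀ u v v', H.Adj u v → H.Adj u v' → v = v' := by
    intro u v v' h1 h2
    have hr := hM.1 _ _ h1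
    exact (hM.2 u hr.1 hr.2.1).unique h1 h2
  refine ⟨fun u v h => ⟨(hM.1 u v h).1, (hM.1 u v h).2.1⟩, hu, hB, ?_⟩
  intro a b z y hab haz hzb hzt hr
  by_contra! hy
  have hra := hM.1 _ _ hab
  obtain ⟨t, ht, -⟩ := hM.2 z (by omega) (by omega)
  have hbt := hzt t ht
  obtain ⟨q, c, d, hc, -⟩ := hr.exists_isTightChain hu
    (fun t h => (hu _ _ _ hab h).le) z haz hy (fun t h => by have := hzt t h; omega)
  have h0 := (hM.1 _ _ (hc.adj 0 hc.pos)).1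
  have hpos := hc.pos
  exact hC (q + 2) (by omega) (hc.containsPat h0 hab ht haz hbt)

namespace IsExtendable

variable {w : ℕ → Bool} {n : ℕ} {G : SimpleGraph ℕ}

theorem restrict (h : IsExtendable w n G) {j : ℕ} (hj : j ≤ n) :
    IsExtendable w j (restrictG G j) := by
  refine ⟨?_, ?_, ?_, ?_⟩
  · intro u v huv
    rw [restrictG_adj] at huv
    exact ⟨(h.range _ _ huv.1).1, huv.2.1⟩
  · intro u v v' h1 h2
    rw [restrictG_adj] at h1 h2
    exact h.unique _ _ _ h1.1 h2.1
  · intro i h1 h2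
    rw [h.base i h1 (by omega)]
    refine exists_congr fun t => and_congr_right fun ht => ?_
    rw [restrictG_adj]
    exact ⟨fun h => ⟨h, h2, by omega⟩, fun h => h.1⟩
  · intro a b z y hab haz hzb hzt hr
    rw [restrictG_adj] at hab
    refine h.noReach a b z y hab.1 haz hzb ?_ (hr.mono fun u v _ _ huv => (restrictG_adj.1 huv).1)
    intro t ht
    by_cases htj : t ≤ j
    · exact hzt t (restrictG_adj.2 ⟨ht, by omega, htj⟩)
    · omega

theorem exists_partner (h : IsExtendable w n G) :
    ∃ g : ℕ → ℕ, ∀ i ∈ (Finset.Icc 1 n).filter (fun i => w i = true), g i < i ∧ G.Adj i (g i) := by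
  have : ∀ i, ∃ j, i ∈ (Finset.Icc 1 n).filter (fun i => w i = true) → j < i ∧ G.Adj i j := by
    intro i
    by_cases hi : i ∈ (Finset.Icc 1 n).filter (fun i => w i = true)
    · have hi' := hi
      simp only [Finset.mem_filter, Finset.mem_Icc] at hi'
      obtain ⟨j, hj⟩ := (h.base i hi'.1.1 hi'.1.2).1 hi'.2
      exact ⟨j, fun _ => hj⟩
    · exact ⟨0, fun h => absurd h hi⟩
  choose g hg using this
  exact ⟨g, hg⟩

theorem lt_of_adj_of_false (h : IsExtendable w n G) {i t : ℕ} (hi : w i = false)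
    (hit : G.Adj i t) : i < t := by
  by_contra! hle
  have hr := h.range _ _ hit
  have := hit.ne
  have := (h.base i hr.1 hr.2).2 ⟨t, by omega, hit⟩
  simp_all

theorem eq_true_of_lt (h : IsExtendable w n G) {i t : ℕ} (hi : t < i) (hit : G.Adj i t) :
    w i = true := by
  have hr := h.range _ _ hit
  exact (h.base i hr.1 hr.2).2 ⟨t, hi, hit⟩

theorem eq_false_of_lt (h : IsExtendable w n G) {i t : ℕ} (hi : i < t) (hit : G.Adj i t) :
    w i = false := by
  have hr := h.range _ _ hit
  by_contra hne
  obtain ⟨j, hj, hij⟩ := (h.base i hr.1 hr.2).1 (by simpa using hne)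
  have := h.unique _ _ _ hit hij
  omega

theorem exists_stub (h : IsExtendable w n G)
    (hcard : 2 * ((Finset.Icc 1 n).filter fun i => w i = true).card < n) :
    ∃ x, IsStubOn n G x := by
  obtain ⟨g, hg⟩ := h.exists_partner
  have hsum := Finset.card_filter_add_card_filter_not (s := Finset.Icc 1 n) (fun i => w i = true)
  rw [Nat.card_Icc] at hsum
  have hlt : (((Finset.Icc 1 n).filter fun i => w i = true).image g).card <
      ((Finset.Icc 1 n).filter fun i => ¬ w i = true).card :=
    Finset.card_image_le.trans_lt (by omega)
  obtain ⟨z, hz, hz'⟩ := Finset.exists_mem_notMem_of_card_lt_card hlt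
  simp only [Finset.mem_filter, Finset.mem_Icc, Bool.not_eq_true] at hz
  refine ⟨z, hz.1.1, hz.1.2, fun t ht => hz' ?_⟩
  have hzt := h.lt_of_adj_of_false hz.2 ht
  have hr := h.range _ _ ht.symm
  have hmem : t ∈ (Finset.Icc 1 n).filter fun i => w i = true := by
    simp only [Finset.mem_filter, Finset.mem_Icc]
    exact ⟨hr, h.eq_true_of_lt hzt ht.symm⟩
  exact Finset.mem_image.2 ⟨t, hmem, h.unique _ _ _ (hg t hmem).2 ht.symm⟩

theorem not_isStubOn (h : IsExtendable w n G)
    (hcard : 2 * ((Finset.Icc 1 n).filter fun i => w i = true).card = n) (x : ℕ) :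
    ¬ IsStubOn n G x := by
  rintro ⟨h1, h2, h3⟩
  obtain ⟨g, hg⟩ := h.exists_partner
  have hsum := Finset.card_filter_add_card_filter_not (s := Finset.Icc 1 n) (fun i => w i = true)
  rw [Nat.card_Icc] at hsum
  have hinj : Set.InjOn g ((Finset.Icc 1 n).filter fun i => w i = true : Finset ℕ) := by
    intro i hi j hj hij
    have h1 := (hg i hi).2.symm
    rw [hij] at h1
    exact h.unique _ _ _ h1 (hg j hj).2.symm
  have hsub : ((Finset.Icc 1 n).filter fun i => w i = true).image g ⊆
      (Finset.Icc 1 n).filter fun i => ¬ w i = true := by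
    intro j hj
    obtain ⟨i, hi, rfl⟩ := Finset.mem_image.1 hj
    have hgi := hg i hi
    simp only [Finset.mem_filter, Finset.mem_Icc, Bool.not_eq_true]
    exact ⟨h.range _ _ hgi.2.symm, h.eq_false_of_lt hgi.1 hgi.2.symm⟩
  have heq := Finset.eq_of_subset_of_card_le hsub (by
    rw [Finset.card_image_of_injOn hinj]
    omega)
  have hx : x ∈ (Finset.Icc 1 n).filter fun i => ¬ w i = true := by
    simp only [Finset.mem_filter, Finset.mem_Icc]
    refine ⟨⟨h1, h2⟩, fun hw => ?_⟩
    obtain ⟨j, -, hj⟩ := (h.base x h1 h2).1 hw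
    exact h3 j hj
  rw [← heq] at hx
  obtain ⟨i, hi, rfl⟩ := Finset.mem_image.1 hx
  exact h3 i (hg i hi).2.symm

theorem isMatchingOn (h : IsExtendable w n G)
    (hcard : 2 * ((Finset.Icc 1 n).filter fun i => w i = true).card = n) :
    IsMatchingOn n G ∧ HasBase n G w ∧ ∀ p : ℕ, 3 ≤ p → ¬ ContainsPat G (Ck p) := by
  refine ⟨⟨fun u v huv => ?_, fun v h1 h2 => ?_⟩, h.base, fun p hp hC => ?_⟩
  · have a1 := h.range _ _ huv
    have a2 := h.range _ _ huv.symm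
    exact ⟨a1.1, a1.2, a2⟩
  · have hns := h.not_isStubOn hcard v
    have : ∃ u, G.Adj v u := by
      by_contra! hno
      exact hns ⟨h1, h2, hno⟩
    obtain ⟨u, hu⟩ := this
    exact ⟨u, hu, fun t ht => h.unique _ _ _ ht hu⟩
  · obtain ⟨a, b, z, t, y, hab, haz, hzb, hzt, hbt, hr, hzy⟩ := exists_reach_of_containsPat hp hC
    have := h.noReach a b z y hab haz hzb (fun s hs => by
      have := h.unique _ _ _ hs hzt
      omega) hr
    omega

theorem restrict_insertEdge (h : IsExtendable w n G) (x : ℕ) (hx : x ≤ n) :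
    restrictG (insertEdge G x (n + 1)) n = G := by
  ext u v
  rw [restrictG_adj, insertEdge_adj (by omega)]
  constructor
  · rintro ⟨huv | huv | huv, h1, h2⟩
    · exact huv
    · omega
    · omega
  · intro huv
    exact ⟨Or.inl huv, (h.range _ _ huv).2, (h.range _ _ huv.symm).2⟩

theorem insertEdge (h : IsExtendable w n G) (hw : w (n + 1) = true) {x : ℕ}
    (hx : IsStubOn n G x)
    (hmax : ∀ z y, IsStubOn n G z → x < z → Reach G (n + 1) x y → y ≤ z) :
    IsExtendable w (n + 1) (insertEdge G x (n + 1)) := by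
  obtain ⟨hx1, hxn, hxs⟩ := hx
  have hne : x ≠ n + 1 := by omega
  have hrange : ∀ u v, G.Adj u v → 1 ≤ u ∧ u ≤ n ∧ v ≤ n := fun u v huv =>
    ⟨(h.range _ _ huv).1, (h.range _ _ huv).2, (h.range _ _ huv.symm).2⟩
  refine ⟨?_, ?_, ?_, ?_⟩
  · intro u v huv
    rw [insertEdge_adj hne] at huv
    rcases huv with huv | huv | huv
    · have := hrange _ _ huv
      omega
    · omega
    · omega
  · intro u v v' h1 h2
    rw [insertEdge_adj hne] at h1 h2
    rcases h1 with h1 | ⟨rfl, rfl⟩ | ⟨rfl, rfl⟩ <;> rcases h2 with h2 | ⟨h2, h3⟩ | ⟨h2, h3⟩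
    · exact h.unique _ _ _ h1 h2
    · subst h2
      exact absurd h1 (hxs _)
    · have := hrange _ _ h1
      omega
    · exact absurd h2 (hxs _)
    · exact h3.symm
    · omega
    · have := hrange _ _ h2
      omega
    · omega
    · exact h3.symm
  · intro i h1 h2
    by_cases hi : i = n + 1
    · subst hi
      simp only [hw, true_iff]
      exact ⟨x, by omega, (insertEdge_adj hne).2 (Or.inr (Or.inr ⟨rfl, rfl⟩))⟩
    · rw [h.base i h1 (by omega)]
      refine exists_congr fun t => and_congr_right fun ht => ?_
      rw [insertEdge_adj hne]
      constructor
      · exact Or.inl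
      · rintro (h | h | h)
        · exact h
        · omega
        · omega
  · intro a b z y hab haz hzb hzt hr
    rw [insertEdge_adj hne] at hab
    have hr' : b ≤ n + 1 → Reach G b a y := by
      intro hb
      refine hr.mono fun u v hv huv' huv => ?_
      rw [insertEdge_adj hne] at huv
      rcases huv with huv | huv | huv
      · exact huv
      · omega
      · omega
    rcases hab with hab | ⟨rfl, rfl⟩ | hab
    · have hb := hrange _ _ hab
      exact h.noReach a b z y hab haz hzb
        (fun t ht => hzt t ((insertEdge_adj hne).2 (Or.inl ht))) (hr' (by omega))
    · refine hmax z y ⟨by omega, by omega, fun t ht => ?_⟩ haz (hr' le_rfl)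
      have := hzt t ((insertEdge_adj hne).2 (Or.inl ht))
      have := hrange _ _ ht
      omega
    · omega

theorem exists_succ (h : IsExtendable w n G) {m : ℕ} (hD : IsDyckWord m w) (hn : n < m) :
    ∃ G', IsExtendable w (n + 1) G' ∧ restrictG G' n = G := by
  cases hw : w (n + 1) with
  | false =>
    refine ⟨G, ⟨?_, h.unique, ?_, h.noReach⟩, ?_⟩
    · intro u v huv
      have := h.range _ _ huv
      omega
    · intro i h1 h2
      by_cases hi : i = n + 1
      · subst hi
        simp only [hw, Bool.false_eq_true, false_iff, not_exists, not_and]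
        intro j _ hj
        have := h.range _ _ hj
        omega
      · exact h.base i h1 (by omega)
    · ext u v
      rw [restrictG_adj]
      exact ⟨fun h => h.1, fun huv => ⟨huv, (h.range _ _ huv).2, (h.range _ _ huv.symm).2⟩⟩
  | true =>
    have hcount := hD.2 (n + 1) hn
    rw [← Finset.insert_Icc_right_eq_Icc_add_one (by omega), Finset.filter_insert, if_pos hw,
      Finset.card_insert_of_notMem (by simp)] at hcount
    obtain ⟨x₀, hx₀⟩ := h.exists_stub (by omega)
    obtain ⟨x, hx, hxmax⟩ : ∃ x, IsStubOn n G x ∧ ∀ z, IsStubOn n G z → z ≤ x := by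
      classical
      refine ⟨Nat.findGreatest (IsStubOn n G) n, Nat.findGreatest_spec hx₀.2.1 hx₀, ?_⟩
      intro z hz
      exact Nat.le_findGreatest hz.2.1 hz
    refine ⟨_, h.insertEdge hw hx ?_, h.restrict_insertEdge x hx.2.1⟩
    intro z y hz hxz
    have := hxmax z hz
    omega

theorem exists_completion (h : IsExtendable w n G) {m : ℕ} (hD : IsDyckWord m w) (hn : n ≤ m) :
    ∃ H, IsExtendable w m H ∧ restrictG H n = G := by
  induction hk : m - n generalizing n G with
  | zero =>
    obtain rfl : n = m := by omega
    refine ⟨G, h, ?_⟩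
    ext u v
    rw [restrictG_adj]
    exact ⟨fun h => h.1, fun huv => ⟨huv, (h.range _ _ huv).2, (h.range _ _ huv.symm).2⟩⟩
  | succ k ih =>
    obtain ⟨G', hG', rfl⟩ := h.exists_succ hD (by omega)
    obtain ⟨H, hH, rfl⟩ := ih hG' (by omega) (by omega)
    refine ⟨H, hH, ?_⟩
    ext u v
    simp only [restrictG_adj]
    constructor
    · rintro ⟨h1, h2, h3⟩
      exact ⟨⟨h1, by omega, by omega⟩, h2, h3⟩
    · rintro ⟨⟨h1, -, -⟩, h2, h3⟩
      exact ⟨h1, h2, h3⟩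

theorem approxRel_iff (h : IsExtendable w n G) {u v : ℕ} (hu : IsStubOn n G u)
    (hv : IsStubOn n G v) (huv : u < v) :
    ApproxRel G u v ↔ ∃ y, v < y ∧ Reach G (n + 1) u y := by
  constructor
  · rintro (rfl | ⟨p, hp, x, y, hadj, hcross, h1, h2, h3, h4⟩)
    · omega
    have hle : ∀ i < p, y i < n + 1 := fun i hi => by
      have := h.range _ _ (hadj i hi).2.symm
      omega
    have key : ∀ i < p, y i ≤ u ∨ ∃ t, y i ≤ t ∧ Reach G (n + 1) u t := by
      intro i
      induction i with
      | zero =>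
        intro hi
        exact Or.inr ⟨_, le_rfl, .base (hadj 0 hi).2 h1 h2 (hle 0 hi)⟩
      | succ i ih =>
        intro hi
        have hc := hcross i hi
        have hlt := (hadj i (by omega)).1
        have hx : x (i + 1) < y i := by
          rcases hc with hc | hc <;> omega
        by_cases hy : y (i + 1) ≤ u
        · exact Or.inl hy
        right
        rcases ih (by omega) with ih | ⟨t, ht, hr⟩
        · exact ⟨_, le_rfl, .base (hadj _ hi).2 (by omega) (by omega) (hle _ hi)⟩
        · by_cases hyt : y (i + 1) ≤ t
          · exact ⟨t, hyt, hr⟩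
          · exact ⟨_, le_rfl, .step hr (hadj _ hi).2 (by omega) (by omega) (hle _ hi)⟩
    rcases key (p - 1) (by omega) with hy | ⟨t, ht, hr⟩
    · omega
    · exact ⟨t, by omega, hr⟩
  · rintro ⟨y, hvy, hr⟩
    obtain ⟨q, c, d, hc, -⟩ := hr.exists_isTightChain h.unique
      (fun t ht => absurd ht (hu.2.2 t)) v huv hvy (fun t ht => absurd ht (hv.2.2 t))
    exact hc.approxRel

end IsExtendable

theorem ApproxRel.symm {G : SimpleGraph ℕ} {u v : ℕ} (h : ApproxRel G u v) : ApproxRel G v u := by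
  rcases h with rfl | ⟨p, hp, x, y, hadj, hcross, h1, h2, h3, h4⟩
  · exact Or.inl rfl
  refine Or.inr ⟨p, hp, fun i => x (p - 1 - i), fun i => y (p - 1 - i),
    fun i hi => hadj _ (by omega), fun i hi => ?_, h3, h4, ?_, ?_⟩
  · have hc := hcross (p - 1 - (i + 1)) (by omega)
    rw [show p - 1 - (i + 1) + 1 = p - 1 - i by omega] at hc
    exact hc.symm
  · simpa using h1
  · simpa using h2

namespace IsExtendable

variable {w : ℕ → Bool} {n : ℕ} {G : SimpleGraph ℕ}

theorem approxRel_trans (h : IsExtendable w n G) {u v t : ℕ} (hu : IsStubOn n G u)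
    (hv : IsStubOn n G v) (ht : IsStubOn n G t) (huv : ApproxRel G u v) (hvt : ApproxRel G v t) :
    ApproxRel G u t := by
  wlog hut : u < t generalizing u t
  · rcases (not_lt.1 hut).eq_or_lt with rfl | hlt
    · exact Or.inl rfl
    · exact (this ht hu hvt.symm huv.symm hlt).symm
  rcases lt_trichotomy u v with huv' | rfl | huv'
  · rw [h.approxRel_iff hu hv huv'] at huv
    rw [h.approxRel_iff hu ht hut]
    obtain ⟨y, hy, hr⟩ := huv
    rcases lt_trichotomy v t with hvt' | rfl | hvt'
    · rw [h.approxRel_iff hv ht hvt'] at hvt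
      obtain ⟨y', hy', hr'⟩ := hvt
      obtain ⟨s, hs, hrs⟩ := hr.trans hy hr'
      exact ⟨s, by omega, hrs⟩
    · exact ⟨y, hy, hr⟩
    · exact ⟨y, by omega, hr⟩
  · exact hvt
  · rw [h.approxRel_iff hv ht (by omega)] at hvt
    rw [h.approxRel_iff hu ht hut]
    obtain ⟨y, hy, hr⟩ := hvt
    rcases hr.shift huv' with hle | ⟨s, hs, hrs⟩
    · omega
    · exact ⟨s, by omega, hrs⟩

/-- The `≈`-blocks are in bijection with the stubs that are the maximum of their block. -/
theorem card_blocks (h : IsExtendable w n G) :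
    Nat.card {x : ℕ // IsStubOn n G x ∧ ∀ y, IsStubOn n G y → ApproxRel G x y → y ≤ x} =
    Nat.card {B : Set ℕ // ∃ x : ℕ, IsStubOn n G x ∧
      B = {y : ℕ | IsStubOn n G y ∧ ApproxRel G x y}} := by
  refine Nat.card_eq_of_bijective (fun x => ⟨{y | IsStubOn n G y ∧ ApproxRel G x.1 y},
    x.1, x.2.1, rfl⟩) ⟨?_, ?_⟩
  · rintro ⟨x, hx, hxm⟩ ⟨x', hx', hxm'⟩ heq
    have heq' : {y | IsStubOn n G y ∧ ApproxRel G x y} = {y | IsStubOn n G y ∧ ApproxRel G x' y} :=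
      congrArg Subtype.val heq
    have m1 : x ∈ {y | IsStubOn n G y ∧ ApproxRel G x' y} := by
      rw [← heq']
      exact ⟨hx, Or.inl rfl⟩
    have m2 : x' ∈ {y | IsStubOn n G y ∧ ApproxRel G x y} := by
      rw [heq']
      exact ⟨hx', Or.inl rfl⟩
    exact Subtype.ext (le_antisymm (hxm' x m1.1 m1.2) (hxm x' m2.1 m2.2))
  · rintro ⟨_, u, hu, rfl⟩
    classical
    obtain ⟨x, ⟨hx, hux⟩, hmax⟩ : ∃ x, (IsStubOn n G x ∧ ApproxRel G u x) ∧
        ∀ z, IsStubOn n G z ∧ ApproxRel G u z → z ≤ x := by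
      refine ⟨Nat.findGreatest (fun z => IsStubOn n G z ∧ ApproxRel G u z) n,
        Nat.findGreatest_spec (P := fun z => IsStubOn n G z ∧ ApproxRel G u z) hu.2.1
          ⟨hu, Or.inl rfl⟩, fun z hz => Nat.le_findGreatest hz.1.2.1 hz⟩
    refine ⟨⟨x, hx, fun y hy hxy => hmax y ⟨hy, h.approxRel_trans hu hx hy hux hxy⟩⟩, ?_⟩
    refine Subtype.ext (Set.ext fun y => ?_)
    exact and_congr_right fun hy =>
      ⟨fun hxy => h.approxRel_trans hu hx hy hux hxy,
        fun huy => h.approxRel_trans hx hu hy hux.symm huy⟩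

theorem exists_matching (h : IsExtendable w n G) {m : ℕ} (hD : IsDyckWord m w) (hn : n < m)
    (hw : w (n + 1) = true) {x : ℕ} (hx : IsStubOn n G x)
    (hmax : ∀ y, IsStubOn n G y → ApproxRel G x y → y ≤ x) :
    ∃ H, IsMatchingOn m H ∧ HasBase m H w ∧ (∀ p : ℕ, 3 ≤ p → ¬ ContainsPat H (Ck p)) ∧
      restrictG H n = G ∧ restrictG H (n + 1) = _root_.insertEdge G x (n + 1) := by
  have hext := h.insertEdge hw hx (fun z y hz hxz hr => by
    by_contra! hy
    have := hmax z hz ((h.approxRel_iff hx hz hxz).2 ⟨y, hy, hr⟩)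
    omega)
  obtain ⟨H, hH, hres⟩ := hext.exists_completion hD hn
  obtain ⟨h1, h2, h3⟩ := hH.isMatchingOn hD.1
  refine ⟨H, h1, h2, h3, ?_, hres⟩
  rw [← h.restrict_insertEdge x hx.2.1, ← hres]
  ext u v
  simp only [restrictG_adj]
  constructor
  · rintro ⟨h1, h2, h3⟩
    exact ⟨⟨h1, by omega, by omega⟩, h2, h3⟩
  · rintro ⟨⟨h1, -, -⟩, h2, h3⟩
    exact ⟨h1, h2, h3⟩

/-- Closing a stub of `G[n]` at `n + 1` closes the maximum of its `≈`-block. -/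
theorem exists_restrict_succ {m : ℕ} (h : IsExtendable w m G) (hn : n < m)
    (hw : w (n + 1) = true) :
    ∃ x, IsStubOn n (restrictG G n) x ∧
      (∀ y, IsStubOn n (restrictG G n) y → ApproxRel (restrictG G n) x y → y ≤ x) ∧
      restrictG G (n + 1) = _root_.insertEdge (restrictG G n) x (n + 1) := by
  obtain ⟨x, hxn, hadj⟩ := (h.base (n + 1) (by omega) hn).1 hw
  have hres := h.restrict hn.le
  have hx : IsStubOn n (restrictG G n) x := by
    refine ⟨(h.range _ _ hadj.symm).1, by omega, fun t ht => ?_⟩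
    rw [restrictG_adj] at ht
    have := h.unique _ _ _ ht.1 hadj.symm
    omega
  refine ⟨x, hx, fun y hy hxy => ?_, ?_⟩
  · by_contra! hlt
    obtain ⟨t, hyt, hr⟩ := (hres.approxRel_iff hx hy hlt).1 hxy
    have := h.noReach x (n + 1) y t hadj.symm hlt (by have := hy.2.1; omega) (fun s hs => by
      by_contra! hsn
      rcases hsn.eq_or_lt with rfl | hsn
      · have := h.unique _ _ _ hs.symm hadj
        omega
      · exact hy.2.2 s (restrictG_adj.2 ⟨hs, hy.2.1, by omega⟩))
      (hr.mono fun u v _ _ huv => (restrictG_adj.1 huv).1)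
    omega
  · ext u v
    rw [insertEdge_adj (by omega), restrictG_adj, restrictG_adj]
    constructor
    · rintro ⟨huv, h1, h2⟩
      by_cases hu : u = n + 1
      · subst hu
        exact Or.inr (Or.inr ⟨rfl, h.unique _ _ _ huv hadj⟩)
      by_cases hv : v = n + 1
      · subst hv
        exact Or.inr (Or.inl ⟨h.unique _ _ _ huv.symm hadj, rfl⟩)
      exact Or.inl ⟨huv, by omega, by omega⟩
    · rintro (⟨huv, h1, h2⟩ | ⟨rfl, rfl⟩ | ⟨rfl, rfl⟩)
      · exact ⟨huv, by omega, by omega⟩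
      · exact ⟨hadj.symm, by omega, le_rfl⟩
      · exact ⟨hadj, le_rfl, by omega⟩

end IsExtendable

/-- if `H' = H[k]` for some matching `H` on `[2m]` with base `w` avoiding
every `C_p` (`p ≥ 3`), and `w_{k+1} = 1`, then every stub `x` of `H'` that is the maximum
of its `≈`-block extends to such a matching `H₀` with `H₀[k] = H'` and `{x,k+1}` an edge;
consequently the number of distinct graphs `H[k+1]` over all such `H` with `H[k] = H'`
equals the number of `≈`-blocks of `H'`. -/
theorem stmt13 (m k : ℕ) (hm : 0 < m) (w : ℕ → Bool) (hw : IsDyckWord (2*m) w)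
    (hk : k < 2*m) (hwk : w (k+1) = true) (H' : SimpleGraph ℕ)
    (hcons : ∃ H : SimpleGraph ℕ, IsMatchingOn (2*m) H ∧ HasBase (2*m) H w ∧
      (∀ p : ℕ, 3 ≤ p → ¬ ContainsPat H (Ck p)) ∧ restrictG H k = H') :
    (∀ x : ℕ, IsStubOn k H' x →
      (∀ y : ℕ, IsStubOn k H' y → ApproxRel H' x y → y ≤ x) →
      ∃ H₀ : SimpleGraph ℕ, IsMatchingOn (2*m) H₀ ∧ HasBase (2*m) H₀ w ∧
        (∀ p : ℕ, 3 ≤ p → ¬ ContainsPat H₀ (Ck p)) ∧ restrictG H₀ k = H' ∧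
        H₀.Adj x (k+1)) ∧
    Nat.card {H'' : SimpleGraph ℕ // ∃ H : SimpleGraph ℕ, IsMatchingOn (2*m) H ∧
        HasBase (2*m) H w ∧ (∀ p : ℕ, 3 ≤ p → ¬ ContainsPat H (Ck p)) ∧
        restrictG H k = H' ∧ restrictG H (k+1) = H''} =
    Nat.card {B : Set ℕ // ∃ x : ℕ, IsStubOn k H' x ∧
        B = {y : ℕ | IsStubOn k H' y ∧ ApproxRel H' x y}} := by
  obtain ⟨H, hM, hB, hC, rfl⟩ := hcons
  have hH := (hM.isExtendable hB hC).restrict hk.le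
  have hne : ∀ x, IsStubOn k (restrictG H k) x → x ≠ k + 1 := fun x hx => by
    have := hx.2.1
    omega
  refine ⟨fun x hx hmax => ?_, ?_⟩
  · obtain ⟨H₀, h1, h2, h3, h4, h5⟩ := hH.exists_matching hw hk hwk hx hmax
    refine ⟨H₀, h1, h2, h3, h4, ?_⟩
    have : (restrictG H₀ (k + 1)).Adj x (k + 1) := by
      rw [h5, insertEdge_adj (hne x hx)]
      exact Or.inr (Or.inl ⟨rfl, rfl⟩)
    exact (restrictG_adj.1 this).1
  · rw [← hH.card_blocks]
    symm
    refine Nat.card_eq_of_bijective (fun x => ⟨insertEdge (restrictG H k) x.1 (k + 1),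
      hH.exists_matching hw hk hwk x.2.1 x.2.2⟩) ⟨?_, ?_⟩
    · rintro ⟨x, hx, hxm⟩ ⟨x', hx', hxm'⟩ heq
      have heq' : insertEdge (restrictG H k) x (k + 1) = insertEdge (restrictG H k) x' (k + 1) :=
        congrArg Subtype.val heq
      have hadj : (insertEdge (restrictG H k) x (k + 1)).Adj x (k + 1) :=
        (insertEdge_adj (hne x hx)).2 (Or.inr (Or.inl ⟨rfl, rfl⟩))
      rw [heq', insertEdge_adj (hne x' hx')] at hadj
      refine Subtype.ext ?_
      rcases hadj with hadj | hadj | hadj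
      · exact absurd hadj (hx.2.2 _)
      · exact hadj.1
      · exact absurd hadj.1 (hne x hx)
    · rintro ⟨_, K, h1, h2, h3, h4, rfl⟩
      obtain ⟨x, hx, hmax, hins⟩ := (h1.isExtendable h2 h3).exists_restrict_succ hk hwk
      rw [h4] at hx hmax hins
      exact ⟨⟨x, hx, hmax⟩, Subtype.ext hins.symm⟩
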